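/- arXiv:cs/0211002 — 3 statements merged into one kernel-verified Lean document; each statement's English description precedes it below -/
import Mathlib

section
/- (Soundness for Nash equilibria) For every interpretation I, mechanism γ, and e-predicates P, Q: if I ⊢ {P}γ{Q}, then the Nash-equilibrium variant of validity holds, i.e., for every (s,o) ∈ P there exist an outcome function ô ∈ Ô_Q and a strategy profile σ such that σ is a Nash equilibrium in G(γ,s,I,ô) and ô(σ) = o. -/
open scoped Classical

noncomputable section

namespace MPL

/-- Terms over variables `V` and function symbols `F` (function symbols applied to
a stream of arguments; finite arities are modelled by ignoring superfluous arguments). -/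
inductive Term (V F : Type) : Type where
  | var : V → Term V F
  | app : F → (ℕ → Term V F) → Term V F

/-- Boolean expressions over variables `V`, function symbols `F` and relation symbols `R`. -/
inductive BExp (V F R : Type) : Type where
  | tt : BExp V F R
  | rel : R → (ℕ → Term V F) → BExp V F R
  | not : BExp V F R → BExp V F R
  | and : BExp V F R → BExp V F R → BExp V F R

/-- MPL mechanisms: assignment, sequential composition, conditional, while-loop,
and simultaneous choice `ch_A(X)` for a finite nonempty set `A` of agents with
distinct choice variables `X a` for `a ∈ A`. -/
inductive Mech (Ag V F R : Type) : Type where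
  | assign : V → Term V F → Mech Ag V F R
  | seq : Mech Ag V F R → Mech Ag V F R → Mech Ag V F R
  | ite : BExp V F R → Mech Ag V F R → Mech Ag V F R → Mech Ag V F R
  | wh : BExp V F R → Mech Ag V F R → Mech Ag V F R
  | choice : (A : Finset Ag) → A.Nonempty → (X : Ag → V) → Set.InjOn X ↑A → Mech Ag V F R

/-- An interpretation: a domain, interpretations of the function and relation symbols,
and for every agent a preference preorder on the domain with a uniformly worst element. -/
structure Interp (Ag V F R : Type) : Type 1 where
  D : Type
  funI : F → (ℕ → D) → D
  relI : R → (ℕ → D) → Prop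
  /-- `pref a d d'` means `d ≥_a d'`. -/
  pref : Ag → D → D → Prop
  pref_refl : ∀ a d, pref a d d
  pref_trans : ∀ a d1 d2 d3, pref a d1 d2 → pref a d2 d3 → pref a d1 d3
  worst : D
  worst_least : ∀ a d, pref a d worst

variable {Ag V F R : Type}

/-- A state assigns a domain element to every mechanism variable. -/
abbrev State (I : Interp Ag V F R) : Type := V → I.D

/-- Value of a term in an interpretation at a state. -/
def Term.eval (I : Interp Ag V F R) (s : State I) : Term V F → I.D
  | .var x => s x
  | .app f ts => I.funI f (fun n => (ts n).eval I s)

/-- Truth of a boolean expression in an interpretation at a state. -/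
def BExp.holds (I : Interp Ag V F R) (s : State I) : BExp V F R → Prop
  | .tt => True
  | .rel r ts => I.relI r (fun n => (ts n).eval I s)
  | .not b => ¬ b.holds I s
  | .and b1 b2 => b1.holds I s ∧ b2.holds I s

/-- A configuration: a mechanism (or `none` for the empty mechanism Λ) together with a state. -/
abbrev Cfg (I : Interp Ag V F R) : Type := Option (Mech Ag V F R) × State I

/-- Update a state at one variable. -/
def updState (I : Interp Ag V F R) (s : State I) (x : V) (d : I.D) : State I :=
  fun y => if y = x then d else s y

/-- The structured operational semantics: labelled transitions `⟨γ,s⟩ →_A ⟨γ',s'⟩`. -/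
inductive Step (I : Interp Ag V F R) : Cfg I → Set Ag → Cfg I → Prop where
  | assign (x : V) (t : Term V F) (s : State I) :
      Step I (some (.assign x t), s) ∅ (none, updState I s x (t.eval I s))
  | choice (A : Finset Ag) (hA : A.Nonempty) (X : Ag → V) (hX : Set.InjOn X ↑A)
      (s s' : State I) (hagree : ∀ y : V, (∀ a ∈ A, X a ≠ y) → s' y = s y) :
      Step I (some (.choice A hA X hX), s) ↑A (none, s')
  | seqFin {γ1 γ2 s L s'} : Step I (some γ1, s) L (none, s') →
      Step I (some (.seq γ1 γ2), s) L (some γ2, s')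
  | seqStep {γ1 γ2 s L γ1' s'} : Step I (some γ1, s) L (some γ1', s') →
      Step I (some (.seq γ1 γ2), s) L (some (.seq γ1' γ2), s')
  | iteT {B γ1 γ2 s} : B.holds I s → Step I (some (.ite B γ1 γ2), s) ∅ (some γ1, s)
  | iteF {B γ1 γ2 s} : ¬ B.holds I s → Step I (some (.ite B γ1 γ2), s) ∅ (some γ2, s)
  | whF {B γ s} : ¬ B.holds I s → Step I (some (.wh B γ), s) ∅ (none, s)
  | whT {B γ s} : B.holds I s → Step I (some (.wh B γ), s) ∅ (some (.seq γ (.wh B γ)), s)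

/-- A (partial) history of the game rooted at `c0`: a nonempty finite sequence of
configurations starting at `c0` and linked by transitions. -/
def IsHist (I : Interp Ag V F R) (c0 : Cfg I) (h : List (Cfg I)) : Prop :=
  h.head? = some c0 ∧ h.Chain' (fun c c' => ∃ L, Step I c L c')

/-- A strategy profile: for every agent a strategy assigning a chosen value to each history. -/
abbrev Profile (I : Interp Ag V F R) : Type := Ag → List (Cfg I) → I.D

/-- The state resulting from the agents in `A` choosing values for their variables
`X a` according to the profile `σ` at history `h`. -/
def chooseVal (I : Interp Ag V F R) (A : Finset Ag) (X : Ag → V) (σ : Profile I)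
    (h : List (Cfg I)) (s : State I) : State I :=
  fun y => if hy : ∃ a, a ∈ A ∧ X a = y then σ hy.choose h else s y

/-- The successor configuration of a (non-empty) configuration, as determined by the
operational semantics together with the choices prescribed by the profile `σ` at history `h`. -/
def next (I : Interp Ag V F R) (σ : Profile I) (h : List (Cfg I)) :
    Mech Ag V F R → State I → Cfg I
  | .assign x t, s => (none, updState I s x (t.eval I s))
  | .choice A _ X _, s => (none, chooseVal I A X σ h s)
  | .seq γ1 γ2, s =>
      match next I σ h γ1 s with
      | (none, s') => (some γ2, s')
      | (some γ1', s') => (some (.seq γ1' γ2), s')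
  | .ite B γ1 γ2, s => if B.holds I s then (some γ1, s) else (some γ2, s)
  | .wh B γ, s => if B.holds I s then (some (.seq γ (.wh B γ)), s) else (none, s)

/-- Extend a history by one step of play according to `σ` (histories ending in Λ stay put). -/
def extend (I : Interp Ag V F R) (σ : Profile I) (h : List (Cfg I)) : List (Cfg I) :=
  match h.getLast? with
  | some (some γ, s) => h ++ [next I σ h γ s]
  | _ => h

/-- The history of the unique run determined by profile `σ` from `c0`, after `n` steps. -/
def runH (I : Interp Ag V F R) (c0 : Cfg I) (σ : Profile I) : ℕ → List (Cfg I)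
  | 0 => [c0]
  | n + 1 => extend I σ (runH I c0 σ n)

/-- A run: the (possibly infinite) sequence of configurations of a maximal play. -/
abbrev Run (I : Interp Ag V F R) : Type := ℕ → Option (Cfg I)

/-- The unique maximal run determined by profile `σ` from initial configuration `c0`. -/
def runOf (I : Interp Ag V F R) (c0 : Cfg I) (σ : Profile I) : Run I :=
  fun n => (runH I c0 σ n)[n]?

/-- `run(σ)` is finite (reaches the empty mechanism Λ). -/
def Terminates (I : Interp Ag V F R) (c0 : Cfg I) (σ : Profile I) : Prop :=
  ∃ n, ∃ s : State I, (runH I c0 σ n).getLast? = some ((none : Option (Mech Ag V F R)), s)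

/-- The final state `s_σ` of a finite run. -/
def finalState (I : Interp Ag V F R) {c0 : Cfg I} {σ : Profile I}
    (h : Terminates I c0 σ) : State I :=
  h.choose_spec.choose

/-- An outcome function assigns an element of the domain to every terminal history
(represented by the corresponding run). -/
abbrev OutcomeF (I : Interp Ag V F R) : Type := Run I → I.D

/-- An extended predicate (e-predicate): a set of pairs (state, outcome). -/
abbrev EPred (I : Interp Ag V F R) : Type := Set (State I × I.D)

/-- `ô ∈ Ô_Q`: every finite run is assigned an outcome satisfying `Q` at its final state. -/
def memOhat (I : Interp Ag V F R) (c0 : Cfg I) (Q : EPred I) (oh : OutcomeF I) : Prop :=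
  ∀ σ : Profile I, ∀ ht : Terminates I c0 σ, (finalState I ht, oh (runOf I c0 σ)) ∈ Q

/-- `σ` is a Nash equilibrium in the game rooted at `c0` with outcome function `oh`. -/
def NashEq (I : Interp Ag V F R) (c0 : Cfg I) (oh : OutcomeF I) (σ : Profile I) : Prop :=
  ∀ (i : Ag) (τ : Profile I), (∀ j, j ≠ i → τ j = σ j) →
    I.pref i (oh (runOf I c0 σ)) (oh (runOf I c0 τ))

/-- Prepend a finite sequence of configurations to a run. -/
def prependRun (I : Interp Ag V F R) (l : List (Cfg I)) (ρ : Run I) : Run I :=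
  fun n => if hn : n < l.length then some l[n] else ρ (n - l.length)

/-- Restriction of an outcome function to the subgame reached via history `h`. -/
def restrictO (I : Interp Ag V F R) (h : List (Cfg I)) (oh : OutcomeF I) : OutcomeF I :=
  fun ρ => oh (prependRun I h.dropLast ρ)

/-- Restriction of a strategy profile to the subgame reached via history `h`. -/
def restrictP (I : Interp Ag V F R) (h : List (Cfg I)) (σ : Profile I) : Profile I :=
  fun a h' => σ a (h.dropLast ++ h')

/-- `σ` is a subgame-perfect equilibrium in `G(γ,s,I,oh)`: its restriction to every
subgame (rooted at any configuration reachable from `⟨γ,s⟩`) is a Nash equilibrium there. -/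
def SPE (I : Interp Ag V F R) (γ : Mech Ag V F R) (s : State I)
    (oh : OutcomeF I) (σ : Profile I) : Prop :=
  ∀ (h : List (Cfg I)) (c : Cfg I), IsHist I (some γ, s) h → h.getLast? = some c →
    NashEq I c (restrictO I h oh) (restrictP I h σ)

/-- The correctness assertion `I ⊨ {P} γ {Q}`. -/
def Valid (I : Interp Ag V F R) (P : EPred I) (γ : Mech Ag V F R) (Q : EPred I) : Prop :=
  ∀ so ∈ P, ∃ (oh : OutcomeF I) (σ : Profile I),
    memOhat I (some γ, so.1) Q oh ∧ SPE I γ so.1 oh σ ∧ oh (runOf I (some γ, so.1) σ) = so.2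

/-- The weakest precondition `wpre(γ,Q,I)`. -/
def wpre (I : Interp Ag V F R) (γ : Mech Ag V F R) (Q : EPred I) : EPred I :=
  {so | ∃ (oh : OutcomeF I) (σ : Profile I),
    memOhat I (some γ, so.1) Q oh ∧ SPE I γ so.1 oh σ ∧ oh (runOf I (some γ, so.1) σ) = so.2}

/-- The substituted e-predicate `Q[x/t]`. -/
def substPred (I : Interp Ag V F R) (Q : EPred I) (x : V) (t : Term V F) : EPred I :=
  {so | (updState I so.1 x (t.eval I so.1), so.2) ∈ Q}

/-- `B^I ∩ P`. -/
def gate (I : Interp Ag V F R) (B : BExp V F R) (P : EPred I) : EPred I :=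
  {so | so ∈ P ∧ B.holds I so.1}

/-- `(¬B)^I ∩ P`. -/
def gateN (I : Interp Ag V F R) (B : BExp V F R) (P : EPred I) : EPred I :=
  {so | so ∈ P ∧ ¬ B.holds I so.1}

/-- The Hoare-style calculus for mechanisms: `I ⊢ {P} γ {Q}`. -/
inductive Deriv (I : Interp Ag V F R) : EPred I → Mech Ag V F R → EPred I → Prop where
  | assign (Q : EPred I) (x : V) (t : Term V F) :
      Deriv I (substPred I Q x t) (.assign x t) Q
  | choice (A : Finset Ag) (hA : A.Nonempty) (X : Ag → V) (hX : Set.InjOn X ↑A)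
      (Q : EPred I) :
      Deriv I (wpre I (.choice A hA X hX) Q) (.choice A hA X hX) Q
  | comp {P R' Q : EPred I} {γ1 γ2 : Mech Ag V F R} :
      Deriv I P γ1 R' → Deriv I R' γ2 Q → Deriv I P (.seq γ1 γ2) Q
  | ifR {P Q : EPred I} {B : BExp V F R} {γ1 γ2 : Mech Ag V F R} :
      Deriv I (gate I B P) γ1 Q → Deriv I (gateN I B P) γ2 Q →
      Deriv I P (.ite B γ1 γ2) Q
  | whileR {P : EPred I} {B : BExp V F R} {γ : Mech Ag V F R} :
      Deriv I (gate I B P) γ P → Deriv I P (.wh B γ) (gateN I B P)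
  | conseq {P P' Q Q' : EPred I} {γ : Mech Ag V F R} :
      P ⊆ P' → Deriv I P' γ Q' → Q' ⊆ Q → Deriv I P γ Q

/-- The Nash-equilibrium variant of validity. -/
def NashValid (I : Interp Ag V F R) (P : EPred I) (γ : Mech Ag V F R) (Q : EPred I) : Prop :=
  ∀ so ∈ P, ∃ (oh : OutcomeF I) (σ : Profile I),
    memOhat I (some γ, so.1) Q oh ∧ NashEq I (some γ, so.1) oh σ ∧
    oh (runOf I (some γ, so.1) σ) = so.2

/-- Mechanisms without any `ch_A` construct, i.e. ordinary programs (MPL(PRG)). -/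
def ChoiceFree : Mech Ag V F R → Prop
  | .assign _ _ => True
  | .seq γ1 γ2 => ChoiceFree γ1 ∧ ChoiceFree γ2
  | .ite _ γ1 γ2 => ChoiceFree γ1 ∧ ChoiceFree γ2
  | .wh _ γ => ChoiceFree γ
  | .choice _ _ _ _ => False

/-- Standard Hoare partial correctness: every finite maximal execution of `γ`
from a state in `P` terminates in a state in `Q`. -/
def HoarePartial (I : Interp Ag V F R) (P : Set (State I)) (γ : Mech Ag V F R)
    (Q : Set (State I)) : Prop :=
  ∀ s ∈ P, ∀ (h : List (Cfg I)) (t : State I),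
    IsHist I (some γ, s) h → h.getLast? = some ((none : Option (Mech Ag V F R)), t) → t ∈ Q

end MPL

namespace MPL

variable {Ag V F R : Type}

/-- The successor configuration when the agents choose the values `v`. -/
def move (I : Interp Ag V F R) (v : Ag → I.D) (γ : Mech Ag V F R) (s : State I) : Cfg I :=
  next I (fun a _ => v a) [] γ s

/-- Put a configuration in front of the continuation `γ₂`. -/
def seqCfg (I : Interp Ag V F R) (γ₂ : Mech Ag V F R) : Cfg I → Cfg I
  | (none, s) => (some γ₂, s)
  | (some γ, s) => (some (.seq γ γ₂), s)

/-- The profile in the subgame after the first configuration `c` of a history. -/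
def shift (I : Interp Ag V F R) (c : Cfg I) (σ : Profile I) : Profile I :=
  fun a h => σ a (c :: h)

theorem next_congr (I : Interp Ag V F R) {σ τ : Profile I} {h h' : List (Cfg I)}
    (e : ∀ a, σ a h = τ a h') (γ : Mech Ag V F R) (s : State I) :
    next I σ h γ s = next I τ h' γ s := by
  induction γ generalizing s with
  | assign x t => rfl
  | seq γ₁ γ₂ ih₁ _ => simp only [next, ih₁]
  | ite B γ₁ γ₂ _ _ => rfl
  | wh B γ _ => rfl
  | choice A hA X hX =>
    simp only [next]
    congr 1
    funext y
    simp only [chooseVal, e]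

theorem next_eq_move (I : Interp Ag V F R) (σ : Profile I) (h : List (Cfg I))
    (γ : Mech Ag V F R) (s : State I) :
    next I σ h γ s = move I (fun a => σ a h) γ s :=
  next_congr I (τ := fun a _ => σ a h) (h' := []) (fun _ => rfl) γ s

theorem move_seq (I : Interp Ag V F R) (v : Ag → I.D) (γ₁ γ₂ : Mech Ag V F R) (s : State I) :
    move I v (.seq γ₁ γ₂) s = seqCfg I γ₂ (move I v γ₁ s) := by
  simp only [move, next]
  rcases next I (fun a _ => v a) [] γ₁ s with ⟨_ | g, s'⟩ <;> rfl

theorem seqCfg_injective (I : Interp Ag V F R) (γ₂ : Mech Ag V F R) :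
    Function.Injective (seqCfg I γ₂) := by
  have hne : ∀ g : Mech Ag V F R, Mech.seq g γ₂ ≠ γ₂ := fun g e => by
    have := congrArg sizeOf e
    simp at this
  rintro ⟨_ | g, s⟩ ⟨_ | g', s'⟩ e <;> simp only [seqCfg, Prod.mk.injEq, Option.some.injEq] at e
  · rw [e.2]
  · exact absurd e.1.symm (hne _)
  · exact absurd e.1 (hne _)
  · rw [e.2, (Mech.seq.inj e.1).1]

/-- A step that two different agents can each bring about by deviating alone is the
prescribed step. -/
theorem move_update_eq (I : Interp Ag V F R) (v : Ag → I.D) {i j : Ag} (hij : i ≠ j)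
    (d e : I.D) (γ : Mech Ag V F R) (s : State I)
    (h : move I (Function.update v i d) γ s = move I (Function.update v j e) γ s) :
    move I (Function.update v i d) γ s = move I v γ s := by
  induction γ generalizing s with
  | assign x t => rfl
  | seq γ₁ γ₂ ih₁ _ =>
    rw [move_seq, move_seq] at h
    rw [move_seq, move_seq, ih₁ s (seqCfg_injective I γ₂ h)]
  | ite B γ₁ γ₂ _ _ => rfl
  | wh B γ _ => rfl
  | choice A hA X hX =>
    simp only [move, next, Prod.mk.injEq, true_and] at h ⊢
    funext y
    have hy := congrFun h y
    simp only [chooseVal] at hy ⊢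
    split_ifs at hy ⊢ with hex
    · by_cases ha : hex.choose = i
      · rw [hy, Function.update_of_ne (ha ▸ hij)]
      · rw [Function.update_of_ne ha]
    · rfl

section Runs

variable (I : Interp Ag V F R)

theorem extend_cons (c : Cfg I) (σ : Profile I) {l : List (Cfg I)} (hl : l ≠ []) :
    extend I σ (c :: l) = c :: extend I (shift I c σ) l := by
  have hlast : (c :: l).getLast? = l.getLast? := by
    rw [List.getLast?_cons, List.getLast?_eq_some_getLast hl]; rfl
  unfold extend
  rw [hlast]
  rcases l.getLast? with _ | ⟨_ | γ, s⟩
  · rfl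
  · rfl
  · simp only [List.cons_append]
    rw [next_congr I (σ := σ) (τ := shift I c σ) (h := c :: l) (h' := l) (fun _ => rfl)]

theorem runH_ne_nil (c : Cfg I) (σ : Profile I) (n : ℕ) : runH I c σ n ≠ [] := by
  induction n with
  | zero => simp [runH]
  | succ n ih =>
    simp only [runH, extend]
    split <;> simp [ih]

theorem runH_none (s : State I) (σ : Profile I) (n : ℕ) :
    runH I (none, s) σ n = [(none, s)] := by
  induction n with
  | zero => rfl
  | succ n ih => rw [runH, ih]; rfl

theorem runH_some (γ : Mech Ag V F R) (s : State I) (σ : Profile I) (n : ℕ) :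
    runH I (some γ, s) σ (n + 1) = (some γ, s) ::
      runH I (move I (fun a => σ a [(some γ, s)]) γ s) (shift I (some γ, s) σ) n := by
  induction n with
  | zero => simp [runH, extend, next_eq_move]
  | succ n ih => rw [runH, ih, extend_cons I _ _ (runH_ne_nil I _ _ _)]; rfl

theorem runOf_zero (c : Cfg I) (σ : Profile I) : runOf I c σ 0 = some c := rfl

theorem runOf_none (s : State I) (σ : Profile I) (n : ℕ) :
    runOf I (none, s) σ (n + 1) = none := by
  simp [runOf, runH_none]

theorem runOf_some (γ : Mech Ag V F R) (s : State I) (σ : Profile I) (n : ℕ) :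
    runOf I (some γ, s) σ (n + 1) =
      runOf I (move I (fun a => σ a [(some γ, s)]) γ s) (shift I (some γ, s) σ) n := by
  simp [runOf, runH_some]

theorem exists_runOf_of_getLast? {c : Cfg I} {σ : Profile I} {n : ℕ} {t : State I}
    (h : (runH I c σ n).getLast? = some (none, t)) : ∃ m, runOf I c σ m = some (none, t) := by
  induction n generalizing c σ with
  | zero => exact ⟨0, by simpa [runH, runOf_zero] using h⟩
  | succ n ih =>
    obtain ⟨_ | γ, s⟩ := c
    · exact ⟨0, by simpa [runH_none, runOf_zero] using h⟩
    · rw [runH_some, List.getLast?_cons,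
        List.getLast?_eq_some_getLast (runH_ne_nil I _ _ _)] at h
      obtain ⟨m, hm⟩ := ih ((List.getLast?_eq_some_getLast (runH_ne_nil I _ _ _)).trans h)
      exact ⟨m + 1, (runOf_some I γ s σ m).trans hm⟩

theorem exists_runOf_finalState {c : Cfg I} {σ : Profile I} (ht : Terminates I c σ) :
    ∃ m, runOf I c σ m = some (none, finalState I ht) :=
  exists_runOf_of_getLast? I ht.choose_spec.choose_spec

theorem runOf_final_unique {c : Cfg I} {σ : Profile I} {n m : ℕ} {t t' : State I}
    (h : runOf I c σ n = some (none, t)) (h' : runOf I c σ m = some (none, t')) : t = t' := by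
  induction n generalizing c σ m with
  | zero =>
    obtain rfl : c = (none, t) := by simpa [runOf_zero] using h
    cases m with
    | zero => simpa [runOf_zero] using h'
    | succ m => simp [runOf_none] at h'
  | succ n ih =>
    obtain ⟨_ | γ, s⟩ := c
    · simp [runOf_none] at h
    · cases m with
      | zero => simp [runOf_zero] at h'
      | succ m => exact ih ((runOf_some I ..).symm.trans h) ((runOf_some I ..).symm.trans h')

end Runs

theorem le_gfp_of_le_sup {α : Type*} [CompleteLattice α] (f : α →o α) {a : α}
    (h : a ≤ f (a ⊔ f.gfp)) : a ≤ f.gfp :=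
  le_sup_left.trans <| f.le_gfp <|
    sup_le h (f.map_gfp.symm.le.trans (f.monotone le_sup_right))

section Predicates

variable (I : Interp Ag V F R) (Q : EPred I)

/-- One-step unfolding of `Total`. -/
def totalStep : Set (Cfg I) →o Set (Cfg I) where
  toFun S := {c | match c with
    | (none, t) => ∃ o, (t, o) ∈ Q
    | (some γ, s) => ∀ v, move I v γ s ∈ S}
  monotone' := by
    rintro S T hST ⟨_ | γ, s⟩ h
    · exact h
    · exact fun v => hST (h v)

/-- Configurations from which every terminating play admits an outcome satisfying `Q`. -/
def Total : Set (Cfg I) := (totalStep I Q).gfp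

/-- One-step unfolding of `Holds`. -/
def holdStep (i : Ag) (o : I.D) : Set (Cfg I) →o Set (Cfg I) where
  toFun S := {c | match c with
    | (none, t) => ∃ o', (t, o') ∈ Q ∧ I.pref i o o'
    | (some γ, s) => ∃ v : Ag → I.D, ∀ d, move I (Function.update v i d) γ s ∈ S}
  monotone' := by
    rintro S T hST ⟨_ | γ, s⟩ h
    · exact h
    · exact h.imp fun v hv d => hST (hv d)

/-- Configurations from which the agents other than `i` can ensure that every terminating
play admits an outcome satisfying `Q` that `i` does not prefer to `o`. -/
def Holds (i : Ag) (o : I.D) : Set (Cfg I) := (holdStep I Q i o).gfp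

/-- One-step unfolding of `Stable`. -/
def stableStep (o : I.D) : Set (Cfg I) →o Set (Cfg I) where
  toFun S := {c | match c with
    | (none, t) => (t, o) ∈ Q
    | (some γ, s) => ∃ v : Ag → I.D, move I v γ s ∈ S ∧
        ∀ i d, move I (Function.update v i d) γ s ∈ Holds I Q i o}
  monotone' := by
    rintro S T hST ⟨_ | γ, s⟩ h
    · exact h
    · exact h.imp fun v hv => ⟨hST hv.1, hv.2⟩

/-- Configurations from which there is a play with outcome `o` all of whose unilateral
deviations can be answered by holding the deviating agent down to `o`. -/
def Stable (o : I.D) : Set (Cfg I) := (stableStep I Q o).gfp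

variable {I Q}

theorem total_none {t : State I} : (none, t) ∈ Total I Q ↔ ∃ o, (t, o) ∈ Q :=
  (Set.ext_iff.1 (totalStep I Q).map_gfp _).symm

theorem total_some {γ : Mech Ag V F R} {s : State I} :
    (some γ, s) ∈ Total I Q ↔ ∀ v, move I v γ s ∈ Total I Q :=
  (Set.ext_iff.1 (totalStep I Q).map_gfp _).symm

theorem holds_none {i : Ag} {o : I.D} {t : State I} :
    (none, t) ∈ Holds I Q i o ↔ ∃ o', (t, o') ∈ Q ∧ I.pref i o o' :=
  (Set.ext_iff.1 (holdStep I Q i o).map_gfp _).symm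

theorem holds_some {i : Ag} {o : I.D} {γ : Mech Ag V F R} {s : State I} :
    (some γ, s) ∈ Holds I Q i o ↔
      ∃ v : Ag → I.D, ∀ d, move I (Function.update v i d) γ s ∈ Holds I Q i o :=
  (Set.ext_iff.1 (holdStep I Q i o).map_gfp _).symm

theorem stable_none {o : I.D} {t : State I} : (none, t) ∈ Stable I Q o ↔ (t, o) ∈ Q :=
  (Set.ext_iff.1 (stableStep I Q o).map_gfp _).symm

theorem stable_some {o : I.D} {γ : Mech Ag V F R} {s : State I} :
    (some γ, s) ∈ Stable I Q o ↔ ∃ v : Ag → I.D, move I v γ s ∈ Stable I Q o ∧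
      ∀ i d, move I (Function.update v i d) γ s ∈ Holds I Q i o :=
  (Set.ext_iff.1 (stableStep I Q o).map_gfp _).symm

theorem Stable.holds {o : I.D} {c : Cfg I} (i : Ag) (h : c ∈ Stable I Q o) :
    c ∈ Holds I Q i o := by
  obtain ⟨_ | γ, s⟩ := c
  · exact holds_none.2 ⟨o, stable_none.1 h, I.pref_refl _ _⟩
  · obtain ⟨v, -, hv⟩ := stable_some.1 h
    exact holds_some.2 ⟨v, hv i⟩

theorem Holds.mono {i : Ag} {o o' : I.D} (ho : I.pref i o o') :
    Holds I Q i o' ⊆ Holds I Q i o := by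
  refine OrderHom.le_gfp _ ?_
  rintro ⟨_ | γ, s⟩ h
  · obtain ⟨o'', h₁, h₂⟩ := holds_none.1 h
    exact ⟨o'', h₁, I.pref_trans _ _ _ _ ho h₂⟩
  · exact holds_some.1 h

/-- The configuration `c` is stable at `o` and total. -/
def Win (I : Interp Ag V F R) (Q : EPred I) (c : Cfg I) (o : I.D) : Prop :=
  c ∈ Stable I Q o ∧ c ∈ Total I Q

theorem Win.of_move {γ : Mech Ag V F R} {s : State I} {c : Cfg I} {o : I.D}
    (hc : ∀ v, move I v γ s = c) (h : Win I Q c o) : Win I Q (some γ, s) o :=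
  ⟨stable_some.2 ⟨fun _ => I.worst, by rw [hc]; exact h.1,
    fun i d => by rw [hc]; exact Stable.holds i h.1⟩,
    total_some.2 fun v => by rw [hc]; exact h.2⟩

theorem Win.mono {Q' : EPred I} (hQ : Q ⊆ Q') {c : Cfg I} {o : I.D} (h : Win I Q c o) :
    Win I Q' c o := by
  have hH : ∀ i, Holds I Q i o ⊆ Holds I Q' i o := fun i => by
    refine OrderHom.le_gfp _ ?_
    rintro ⟨_ | γ, s⟩ h
    · exact (holds_none.1 h).imp fun _ h => ⟨hQ h.1, h.2⟩
    · exact holds_some.1 h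
  have hS : Stable I Q o ⊆ Stable I Q' o := by
    refine OrderHom.le_gfp _ ?_
    rintro ⟨_ | γ, s⟩ h
    · exact hQ (stable_none.1 h)
    · exact (stable_some.1 h).imp fun _ h => ⟨h.1, fun i d => hH i (h.2 i d)⟩
  have hT : Total I Q ⊆ Total I Q' := by
    refine OrderHom.le_gfp _ ?_
    rintro ⟨_ | γ, s⟩ h
    · exact (total_none.1 h).imp fun _ h => hQ h
    · exact total_some.1 h
  exact ⟨hS h.1, hT h.2⟩

theorem Total.seqCfg {P : EPred I} {γ₂ : Mech Ag V F R} {S : Set (Cfg I)}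
    (hP : ∀ s o, (s, o) ∈ P → (some γ₂, s) ∈ totalStep I Q (seqCfg I γ₂ '' Total I P ∪ S))
    {c : Cfg I} (hc : c ∈ Total I P) :
    seqCfg I γ₂ c ∈ totalStep I Q (seqCfg I γ₂ '' Total I P ∪ S) := by
  obtain ⟨_ | g, s⟩ := c
  · obtain ⟨o, ho⟩ := total_none.1 hc
    exact hP s o ho
  · exact fun v => .inl ⟨_, total_some.1 hc v, (move_seq ..).symm⟩

theorem Holds.seqCfg {P : EPred I} {γ₂ : Mech Ag V F R} {i : Ag} {o : I.D} {S : Set (Cfg I)}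
    (hP : ∀ s o', (s, o') ∈ P → I.pref i o o' →
      (some γ₂, s) ∈ holdStep I Q i o (seqCfg I γ₂ '' Holds I P i o ∪ S))
    {c : Cfg I} (hc : c ∈ Holds I P i o) :
    seqCfg I γ₂ c ∈ holdStep I Q i o (seqCfg I γ₂ '' Holds I P i o ∪ S) := by
  obtain ⟨_ | g, s⟩ := c
  · obtain ⟨o', ho, ho'⟩ := holds_none.1 hc
    exact hP s o' ho ho'
  · obtain ⟨v, hv⟩ := holds_some.1 hc
    exact ⟨v, fun d => .inl ⟨_, hv d, (move_seq ..).symm⟩⟩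

theorem Stable.seqCfg {P : EPred I} {γ₂ : Mech Ag V F R} {o : I.D} {S : Set (Cfg I)}
    (hH : ∀ i, seqCfg I γ₂ '' Holds I P i o ⊆ Holds I Q i o)
    (hP : ∀ s, (s, o) ∈ P → (some γ₂, s) ∈ stableStep I Q o (seqCfg I γ₂ '' Stable I P o ∪ S))
    {c : Cfg I} (hc : c ∈ Stable I P o) :
    seqCfg I γ₂ c ∈ stableStep I Q o (seqCfg I γ₂ '' Stable I P o ∪ S) := by
  obtain ⟨_ | g, s⟩ := c
  · exact hP s (stable_none.1 hc)
  · obtain ⟨v, hv, hv'⟩ := stable_some.1 hc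
    exact ⟨v, .inl ⟨_, hv, (move_seq ..).symm⟩,
      fun i d => hH i ⟨_, hv' i d, (move_seq ..).symm⟩⟩

theorem Win.seq {P : EPred I} {γ₁ γ₂ : Mech Ag V F R} {s : State I} {o : I.D}
    (h₁ : Win I P (some γ₁, s) o) (h₂ : ∀ t o, (t, o) ∈ P → Win I Q (some γ₂, t) o) :
    Win I Q (some (.seq γ₁ γ₂), s) o := by
  have hT : MPL.seqCfg I γ₂ '' Total I P ⊆ Total I Q := by
    refine le_gfp_of_le_sup _ ?_
    rintro _ ⟨c, hc, rfl⟩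
    refine Total.seqCfg (fun t o ho => ?_) hc
    exact fun v => .inr (total_some.1 (h₂ t o ho).2 v)
  have hH : ∀ i, MPL.seqCfg I γ₂ '' Holds I P i o ⊆ Holds I Q i o := fun i => by
    refine le_gfp_of_le_sup _ ?_
    rintro _ ⟨c, hc, rfl⟩
    refine Holds.seqCfg (fun t o' ho hle => ?_) hc
    obtain ⟨v, hv⟩ := holds_some.1 (Holds.mono hle (Stable.holds i (h₂ t o' ho).1))
    exact ⟨v, fun d => .inr (hv d)⟩
  have hS : MPL.seqCfg I γ₂ '' Stable I P o ⊆ Stable I Q o := by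
    refine le_gfp_of_le_sup _ ?_
    rintro _ ⟨c, hc, rfl⟩
    refine Stable.seqCfg hH (fun t ho => ?_) hc
    obtain ⟨v, hv, hv'⟩ := stable_some.1 (h₂ t o ho).1
    exact ⟨v, .inr hv, hv'⟩
  exact ⟨hS ⟨_, h₁.1, rfl⟩, hT ⟨_, h₁.2, rfl⟩⟩

theorem move_wh (B : BExp V F R) (γ : Mech Ag V F R) (s : State I) (v : Ag → I.D) :
    move I v (.wh B γ) s =
      if B.holds I s then seqCfg I (.wh B γ) (some γ, s) else (none, s) := rfl

theorem Win.wh {P : EPred I} {B : BExp V F R} {γ : Mech Ag V F R}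
    (hγ : ∀ s o, (s, o) ∈ gate I B P → Win I P (some γ, s) o) {s : State I} {o : I.D}
    (hs : (s, o) ∈ P) : Win I (gateN I B P) (some (.wh B γ), s) o := by
  have hT : MPL.seqCfg I (.wh B γ) '' Total I P ⊆ Total I (gateN I B P) := by
    refine le_gfp_of_le_sup _ ?_
    rintro _ ⟨c, hc, rfl⟩
    refine Total.seqCfg (fun t o ho v => ?_) hc
    rw [move_wh]
    split_ifs with hB
    · exact .inl ⟨_, (hγ t o ⟨ho, hB⟩).2, rfl⟩
    · exact .inr (total_none.2 ⟨o, ho, hB⟩)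
  have hH : ∀ i, MPL.seqCfg I (.wh B γ) '' Holds I P i o ⊆ Holds I (gateN I B P) i o := by
    intro i
    refine le_gfp_of_le_sup _ ?_
    rintro _ ⟨c, hc, rfl⟩
    refine Holds.seqCfg (fun t o' ho hle => ⟨fun _ => I.worst, fun d => ?_⟩) hc
    rw [move_wh]
    split_ifs with hB
    · exact .inl ⟨_, Holds.mono hle (Stable.holds i (hγ t o' ⟨ho, hB⟩).1), rfl⟩
    · exact .inr (holds_none.2 ⟨o', ⟨ho, hB⟩, hle⟩)
  have hS : MPL.seqCfg I (.wh B γ) '' Stable I P o ⊆ Stable I (gateN I B P) o := by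
    refine le_gfp_of_le_sup _ ?_
    rintro _ ⟨c, hc, rfl⟩
    refine Stable.seqCfg hH (fun t ho => ⟨fun _ => I.worst, ?_, fun i d => ?_⟩) hc
    · rw [move_wh]
      split_ifs with hB
      · exact .inl ⟨_, (hγ t o ⟨ho, hB⟩).1, rfl⟩
      · exact .inr (stable_none.2 ⟨ho, hB⟩)
    · rw [move_wh]
      split_ifs with hB
      · exact hH i ⟨_, Stable.holds i (hγ t o ⟨ho, hB⟩).1, rfl⟩
      · exact Stable.holds i (stable_none.2 ⟨ho, hB⟩)
  by_cases hB : B.holds I s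
  · have hw := hγ s o ⟨hs, hB⟩
    exact Win.of_move (fun v => (move_wh B γ s v).trans (if_pos hB))
      ⟨hS ⟨_, hw.1, rfl⟩, hT ⟨_, hw.2, rfl⟩⟩
  · exact Win.of_move (fun v => (move_wh B γ s v).trans (if_neg hB))
      ⟨stable_none.2 ⟨hs, hB⟩, total_none.2 ⟨o, hs, hB⟩⟩

theorem SPE.nashEq {γ : Mech Ag V F R} {s : State I} {oh : OutcomeF I} {σ : Profile I}
    (h : SPE I γ s oh σ) : NashEq I (some γ, s) oh σ :=
  h [(some γ, s)] (some γ, s) ⟨rfl, List.isChain_singleton _⟩ rfl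

theorem Win.choice {A : Finset Ag} {hA : A.Nonempty} {X : Ag → V} {hX : Set.InjOn X ↑A}
    {s : State I} {o : I.D} (h : (s, o) ∈ wpre I (.choice A hA X hX) Q) :
    Win I Q (some (.choice A hA X hX), s) o := by
  obtain ⟨oh, σ, hQ, hspe, ho⟩ := h
  have hN := hspe.nashEq
  dsimp only at hQ hN ho
  set γ : Mech Ag V F R := .choice A hA X hX with hγ
  have hmove : ∀ v, ∃ t, move I v γ s = (none, t) := fun v => ⟨_, rfl⟩
  have hmem : ∀ (τ : Profile I) t, move I (fun a => τ a [(some γ, s)]) γ s = (none, t) →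
      (t, oh (runOf I (some γ, s) τ)) ∈ Q := by
    intro τ t ht
    have hterm : Terminates I (some γ, s) τ := ⟨1, t, by rw [runH_some, ht]; rfl⟩
    have h₁ : runOf I (some γ, s) τ 1 = some (none, t) := by rw [runOf_some, ht]; rfl
    obtain ⟨m, hm⟩ := exists_runOf_finalState I hterm
    rw [runOf_final_unique I h₁ hm]
    exact hQ τ hterm
  refine ⟨stable_some.2 ⟨fun a => σ a [(some γ, s)], ?_, fun i d => ?_⟩,
    total_some.2 fun v => ?_⟩
  · obtain ⟨t, ht⟩ := hmove fun a => σ a [(some γ, s)]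
    rw [ht, stable_none, ← ho]
    exact hmem σ t ht
  · obtain ⟨t, ht⟩ := hmove (Function.update (fun a => σ a [(some γ, s)]) i d)
    rw [ht, holds_none]
    refine ⟨_, hmem (Function.update σ i fun _ => d) t ?_, ?_⟩
    · rw [← ht]
      congr 1
      funext a
      by_cases ha : a = i
      · subst ha; simp
      · simp [ha]
    · rw [← ho]
      exact hN i _ fun j hj => Function.update_of_ne hj _ _
  · obtain ⟨t, ht⟩ := hmove v
    rw [ht, total_none]
    exact ⟨_, hmem (fun a _ => v a) t ht⟩

theorem Deriv.win {P : EPred I} {γ : Mech Ag V F R} (h : Deriv I P γ Q) :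
    ∀ s o, (s, o) ∈ P → Win I Q (some γ, s) o := by
  induction h with
  | assign Q x t =>
    intro s o hs
    exact Win.of_move (fun _ => rfl) ⟨stable_none.2 hs, total_none.2 ⟨o, hs⟩⟩
  | choice A hA X hX Q => exact fun s o => Win.choice
  | comp _ _ ih₁ ih₂ => exact fun s o hs => (ih₁ s o hs).seq ih₂
  | @ifR P Q B γ₁ γ₂ _ _ ih₁ ih₂ =>
    intro s o hs
    by_cases hB : B.holds I s
    · exact Win.of_move (fun v => if_pos hB) (ih₁ s o ⟨hs, hB⟩)
    · exact Win.of_move (fun v => if_neg hB) (ih₂ s o ⟨hs, hB⟩)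
  | whileR _ ih => exact fun s o => Win.wh ih
  | conseq hP _ hQ ih => exact fun s o hs => (ih s o (hP hs)).mono hQ

end Predicates

section Strategies

variable (I : Interp Ag V F R) (Q : EPred I) (o : I.D)

/-- Positional choices holding agent `i` down to `o`. -/
def holdChoice (i : Ag) : Cfg I → Ag → I.D
  | (some γ, s) => if h : ∃ v : Ag → I.D, ∀ d, move I (Function.update v i d) γ s ∈ Holds I Q i o
      then h.choose else fun _ => I.worst
  | (none, _) => fun _ => I.worst

/-- The positional profile holding agent `i` down to `o`. -/
def holdProfile (i : Ag) : Profile I :=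
  fun a h => match h.getLast? with
    | some c => holdChoice I Q o i c a
    | none => I.worst

/-- Positional choices along the equilibrium play. -/
def stableChoice : Cfg I → Ag → I.D
  | (some γ, s) => if h : ∃ v : Ag → I.D, move I v γ s ∈ Stable I Q o ∧
        ∀ i d, move I (Function.update v i d) γ s ∈ Holds I Q i o
      then h.choose else fun _ => I.worst
  | (none, _) => fun _ => I.worst

/-- The configuration `c'` arises from `c` by a deviation of agent `i` from the
equilibrium choices. -/
def DeviatesTo (i : Ag) (c c' : Cfg I) : Prop :=
  ∃ γ, c.1 = some γ ∧ ∃ d, c' = move I (Function.update (stableChoice I Q o c) i d) γ c.2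

/-- The equilibrium profile: follow `stableChoice`, and after a unilateral deviation hold the
deviating agent down to `o`. -/
def eqProfile (a : Ag) : List (Cfg I) → I.D
  | [] => I.worst
  | [c] => stableChoice I Q o c a
  | c :: c' :: h =>
    if ∃ γ, c.1 = some γ ∧ c' = move I (stableChoice I Q o c) γ c.2 then eqProfile a (c' :: h)
    else if hd : ∃ i, DeviatesTo I Q o i c c' then holdProfile I Q o hd.choose a (c' :: h)
    else I.worst

variable {I Q o}

theorem holdChoice_spec {i : Ag} {γ : Mech Ag V F R} {s : State I}
    (h : (some γ, s) ∈ Holds I Q i o) (d : I.D) :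
    move I (Function.update (holdChoice I Q o i (some γ, s)) i d) γ s ∈ Holds I Q i o := by
  have hex := holds_some.1 h
  simp only [holdChoice, dif_pos hex]
  exact hex.choose_spec d

theorem stableChoice_spec {γ : Mech Ag V F R} {s : State I}
    (h : (some γ, s) ∈ Stable I Q o) :
    move I (stableChoice I Q o (some γ, s)) γ s ∈ Stable I Q o ∧
      ∀ i d, move I (Function.update (stableChoice I Q o (some γ, s)) i d) γ s
        ∈ Holds I Q i o := by
  have hex := stable_some.1 h
  simp only [stableChoice, dif_pos hex]
  exact hex.choose_spec

theorem eq_update_of_forall_ne {α β : Type*} {f g : α → β} {i : α}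
    (h : ∀ j, j ≠ i → f j = g j) : f = Function.update g i (f i) := by
  funext a
  by_cases ha : a = i
  · subst ha; simp
  · rw [Function.update_of_ne ha, h a ha]

/-- Against `holdProfile`, agent `i` achieves no terminating play better than `o`. -/
theorem exists_pref_of_holdProfile {i : Ag} {n : ℕ} {c : Cfg I} {τ : Profile I} {t : State I}
    (hc : c ∈ Holds I Q i o)
    (hτ : ∀ j, j ≠ i → ∀ h, τ j (c :: h) = holdProfile I Q o i j (c :: h))
    (hn : runOf I c τ n = some (none, t)) : ∃ o', (t, o') ∈ Q ∧ I.pref i o o' := by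
  induction n generalizing c τ with
  | zero =>
    obtain rfl : c = (none, t) := by simpa [runOf_zero] using hn
    exact holds_none.1 hc
  | succ n ih =>
    obtain ⟨_ | γ, s⟩ := c
    · simp [runOf_none] at hn
    · rw [runOf_some] at hn
      refine ih ?_ (fun j hj h => ?_) hn
      · rw [eq_update_of_forall_ne (f := fun a => τ a [(some γ, s)])
          (g := holdChoice I Q o i (some γ, s)) fun j hj => hτ j hj []]
        exact holdChoice_spec hc _
      · refine (hτ j hj _).trans ?_
        simp [holdProfile, List.getLast?_cons]

/-- The terminating play of `eqProfile` satisfies `Q` with outcome `o`. -/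
theorem mem_of_eqProfile {n : ℕ} {c : Cfg I} {τ : Profile I} {t : State I}
    (hc : c ∈ Stable I Q o) (hτ : ∀ j h, τ j (c :: h) = eqProfile I Q o j (c :: h))
    (hn : runOf I c τ n = some (none, t)) : (t, o) ∈ Q := by
  induction n generalizing c τ with
  | zero =>
    obtain rfl : c = (none, t) := by simpa [runOf_zero] using hn
    exact stable_none.1 hc
  | succ n ih =>
    obtain ⟨_ | γ, s⟩ := c
    · simp [runOf_none] at hn
    · have e : (fun a => τ a [(some γ, s)]) = stableChoice I Q o (some γ, s) :=
        funext fun a => (hτ a []).trans rfl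
      rw [runOf_some, e] at hn
      refine ih (stableChoice_spec hc).1 (fun j h => ?_) hn
      refine (hτ j _).trans ?_
      rw [eqProfile, if_pos ⟨γ, rfl, rfl⟩]

variable (I Q o) in
/-- The run `ρ` from `c` arises from `eqProfile` by a deviation of agent `i`. -/
def IsDeviation (i : Ag) (c : Cfg I) (ρ : Run I) : Prop :=
  ∃ τ : Profile I, (∀ j, j ≠ i → ∀ h, τ j (c :: h) = eqProfile I Q o j (c :: h)) ∧
    runOf I c τ = ρ

/-- Every terminating play admits an outcome satisfying `Q` that is no improvement for any
agent that could have brought it about by deviating alone. -/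
theorem exists_outcome {n : ℕ} {c : Cfg I} {τ : Profile I} {t : State I}
    (hc : Win I Q c o) (hn : runOf I c τ n = some (none, t)) :
    ∃ o', (t, o') ∈ Q ∧ ∀ i, IsDeviation I Q o i c (runOf I c τ) → I.pref i o o' := by
  induction n generalizing c τ with
  | zero =>
    obtain rfl : c = (none, t) := by simpa [runOf_zero] using hn
    exact ⟨o, stable_none.1 hc.1, fun i _ => I.pref_refl _ _⟩
  | succ n ih =>
    obtain ⟨_ | γ, s⟩ := c
    · simp [runOf_none] at hn
    rw [runOf_some] at hn
    obtain ⟨c', hc'⟩ : ∃ c', move I (fun a => τ a [(some γ, s)]) γ s = c' := ⟨_, rfl⟩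
    rw [hc'] at hn
    have hT : c' ∈ Total I Q := hc' ▸ total_some.1 hc.2 _
    have key : ∀ i, IsDeviation I Q o i (some γ, s) (runOf I (some γ, s) τ) →
        (∃ d, c' = move I (Function.update (stableChoice I Q o (some γ, s)) i d) γ s) ∧
        ∃ τ' : Profile I, (∀ j, j ≠ i → ∀ h, τ' j (c' :: h) =
          eqProfile I Q o j ((some γ, s) :: c' :: h)) ∧
          runOf I c' τ' = runOf I c' (shift I (some γ, s) τ) := by
      rintro i ⟨τ', hτ', hrun⟩
      have h₁ : move I (fun a => τ' a [(some γ, s)]) γ s = c' := by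
        have := congrFun hrun 1
        simpa [runOf_some, runOf_zero, hc'] using this
      refine ⟨⟨τ' i [(some γ, s)], ?_⟩, shift I (some γ, s) τ', fun j hj h => hτ' j hj _, ?_⟩
      · rw [← h₁, ← eq_update_of_forall_ne (f := fun a => τ' a [(some γ, s)]) fun j hj => ?_]
        exact hτ' j hj []
      · funext m
        have := congrFun hrun (m + 1)
        rwa [runOf_some, runOf_some, h₁, hc'] at this
    by_cases hon : c' = move I (stableChoice I Q o (some γ, s)) γ s
    · have hw : Win I Q c' o := ⟨hon ▸ (stableChoice_spec hc.1).1, hT⟩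
      obtain ⟨o', ho', hpref⟩ := ih hw hn
      refine ⟨o', ho', fun i hi => hpref i ?_⟩
      obtain ⟨-, τ', hτ', hrun⟩ := key i hi
      refine ⟨τ', fun j hj h => (hτ' j hj h).trans ?_, hrun⟩
      rw [eqProfile, if_pos ⟨γ, rfl, hon⟩]
    have hoff : ¬ ∃ γ', ((some γ, s) : Cfg I).1 = some γ' ∧
        c' = move I (stableChoice I Q o (some γ, s)) γ' ((some γ, s) : Cfg I).2 := by
      rintro ⟨γ', e, h⟩
      obtain rfl := Option.some.inj e
      exact hon h
    have huniq : ∀ i j d e,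
        c' = move I (Function.update (stableChoice I Q o (some γ, s)) i d) γ s →
        c' = move I (Function.update (stableChoice I Q o (some γ, s)) j e) γ s → i = j := by
      intro i j d e hi hj
      by_contra hij
      exact hon (hi.trans (move_update_eq I _ hij d e γ s (hi.symm.trans hj)))
    by_cases hdev : ∃ i, IsDeviation I Q o i (some γ, s) (runOf I (some γ, s) τ)
    · obtain ⟨i, hi⟩ := hdev
      obtain ⟨⟨d, hd⟩, τ', hτ', hrun⟩ := key i hi
      have hex : ∃ i, DeviatesTo I Q o i (some γ, s) c' := ⟨i, γ, rfl, d, hd⟩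
      have hchoose : hex.choose = i := by
        obtain ⟨γ', e, d', hd'⟩ := hex.choose_spec
        obtain rfl := Option.some.inj e
        exact huniq _ _ _ _ hd' hd
      obtain ⟨o', ho', hpref⟩ := exists_pref_of_holdProfile (i := i) (n := n) (τ := τ')
        (c := c') (o := o) (Q := Q) (t := t) (hd ▸ (stableChoice_spec hc.1).2 i d)
        (fun j hj h => by
          rw [hτ' j hj h, eqProfile, if_neg hoff, dif_pos hex, hchoose]) (hrun ▸ hn)
      refine ⟨o', ho', fun j hj => ?_⟩
      obtain ⟨⟨e, he⟩, -⟩ := key j hj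
      rwa [huniq j i e d he hd]
    · have htot : ∀ {m : ℕ} {c : Cfg I} {τ : Profile I}, c ∈ Total I Q →
          runOf I c τ m = some (none, t) → ∃ o', (t, o') ∈ Q := by
        intro m
        induction m with
        | zero =>
          intro c τ hc hm
          obtain rfl : c = (none, t) := by simpa [runOf_zero] using hm
          exact total_none.1 hc
        | succ m ihm =>
          rintro ⟨_ | γ, s⟩ τ hc hm
          · simp [runOf_none] at hm
          · exact ihm (total_some.1 hc _) ((runOf_some I ..).symm.trans hm)
      obtain ⟨o', ho'⟩ := htot hT hn
      exact ⟨o', ho', fun i hi => absurd ⟨i, hi⟩ hdev⟩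

theorem Win.exists_nashEq {c : Cfg I} (hc : Win I Q c o) :
    ∃ (oh : OutcomeF I) (σ : Profile I),
      memOhat I c Q oh ∧ NashEq I c oh σ ∧ oh (runOf I c σ) = o := by
  have hgood : ∀ ρ : Run I, ∃ o', (∃ τ, runOf I c τ = ρ) →
      (∀ n t, ρ n = some (none, t) → (t, o') ∈ Q) ∧
      (∀ i, IsDeviation I Q o i c ρ → I.pref i o o') ∧
      (ρ = runOf I c (eqProfile I Q o) → o' = o) := by
    intro ρ
    by_cases hρ : ρ = runOf I c (eqProfile I Q o)
    · refine ⟨o, fun _ => ⟨fun n t hn => ?_, fun _ _ => I.pref_refl _ _, fun _ => rfl⟩⟩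
      exact mem_of_eqProfile hc.1 (fun _ _ => rfl) (hρ ▸ hn)
    by_cases hfin : ∃ n t, ρ n = some (none, t)
    · obtain ⟨n, t, hn⟩ := hfin
      by_cases hτ : ∃ τ, runOf I c τ = ρ
      · obtain ⟨τ, rfl⟩ := hτ
        obtain ⟨o', ho', hpref⟩ := exists_outcome hc hn
        refine ⟨o', fun _ => ⟨fun m t' hm => ?_, hpref, fun h => absurd h hρ⟩⟩
        rwa [← runOf_final_unique I hn hm]
      · exact ⟨o, fun h => absurd h hτ⟩
    · exact ⟨I.worst, fun _ => ⟨fun n t hn => absurd ⟨n, t, hn⟩ hfin,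
        fun i _ => I.worst_least _ _, fun h => absurd h hρ⟩⟩
  choose oh hoh using hgood
  have heq : oh (runOf I c (eqProfile I Q o)) = o := (hoh _ ⟨_, rfl⟩).2.2 rfl
  refine ⟨oh, eqProfile I Q o, fun τ ht => ?_, fun i τ hτ => ?_, heq⟩
  · obtain ⟨m, hm⟩ := exists_runOf_finalState I ht
    exact (hoh _ ⟨τ, rfl⟩).1 m _ hm
  · rw [heq]
    exact (hoh _ ⟨τ, rfl⟩).2.1 i ⟨τ, fun j hj h => by rw [hτ j hj], rfl⟩

end Strategies

end MPL

open MPL in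
/-- Soundness for Nash equilibria: if `I ⊢ {P}γ{Q}`, then for every `(s,o) ∈ P` there
exist `ô ∈ Ô_Q` and a profile `σ` which is a Nash equilibrium in `G(γ,s,I,ô)` with
`ô(σ) = o`. -/
theorem soundness_nash {Ag V F R : Type} (I : Interp Ag V F R)
    (γ : Mech Ag V F R) (P Q : EPred I)
    (h : Deriv I P γ Q) : NashValid I P γ Q :=
  fun so hso => (h.win so.1 so.2 hso).exists_nashEq
end
end

section
/- (Generalization of Hoare partial correctness) For every interpretation I with domain D, every element d ∈ D, every program γ ∈ MPL(PRG) (i.e., a mechanism containing no ch_A construct), and all predicates P, Q (sets of states): the standard partial correctness assertion {P}γ{Q} holds in I if and only if I ⊨ {P*}γ{Q*}, where P* = {(s,d) : s ∈ P} and Q* = {(s,d) : s ∈ Q}. -/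
open scoped Classical

noncomputable section

namespace MPL

/-- The successor prescribed by a profile is reached by a transition. -/
theorem exists_step_next (I : Interp Ag V F R) (σ : Profile I) (h : List (Cfg I))
    (γ : Mech Ag V F R) (s : State I) : ∃ L, Step I (some γ, s) L (next I σ h γ s) := by
  induction γ with
  | assign x t => exact ⟨_, .assign x t s⟩
  | choice A hA X hX =>
    refine ⟨_, .choice A hA X hX s _ fun y hy => dif_neg ?_⟩
    rintro ⟨a, ha, rfl⟩
    exact hy a ha rfl
  | seq γ1 γ2 ih1 _ =>
    obtain ⟨L, hL⟩ := ih1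
    rcases hn : next I σ h γ1 s with ⟨_ | γ1', s'⟩ <;> rw [hn] at hL <;> simp only [next, hn]
    · exact ⟨_, .seqFin hL⟩
    · exact ⟨_, .seqStep hL⟩
  | ite B γ1 γ2 _ _ =>
    by_cases hB : B.holds I s
    · simpa only [next, if_pos hB] using ⟨_, .iteT hB⟩
    · simpa only [next, if_neg hB] using ⟨_, .iteF hB⟩
  | wh B γ _ =>
    by_cases hB : B.holds I s
    · simpa only [next, if_pos hB] using ⟨_, .whT hB⟩
    · simpa only [next, if_neg hB] using ⟨_, .whF hB⟩

/-- Choice-free mechanisms are deterministic: every transition is the one given by `next`. -/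
theorem Step.eq_next {I : Interp Ag V F R} {γ : Mech Ag V F R} {s : State I} {L : Set Ag}
    {c : Cfg I} (hs : Step I (some γ, s) L c) (hγ : ChoiceFree γ)
    (σ : Profile I) (h : List (Cfg I)) : c = next I σ h γ s := by
  induction γ generalizing L c with
  | assign x t => cases hs; rfl
  | choice => exact hγ.elim
  | seq γ1 γ2 ih1 _ =>
    cases hs with
    | seqFin h1 => simp only [next, ← ih1 h1 hγ.1]
    | seqStep h1 => simp only [next, ← ih1 h1 hγ.1]
  | ite B γ1 γ2 _ _ => cases hs <;> simp [next, *]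
  | wh B γ _ => cases hs <;> simp [next, *]

theorem Step.choiceFree {I : Interp Ag V F R} {γ γ' : Mech Ag V F R} {s s' : State I}
    {L : Set Ag} (hs : Step I (some γ, s) L (some γ', s')) (hγ : ChoiceFree γ) :
    ChoiceFree γ' := by
  induction γ generalizing L γ' with
  | assign x t => cases hs
  | choice => exact hγ.elim
  | seq γ1 γ2 ih1 _ =>
    cases hs with
    | seqFin h1 => exact hγ.2
    | seqStep h1 => exact ⟨ih1 h1 hγ.1, hγ.2⟩
  | ite B γ1 γ2 _ _ =>
    cases hs
    · exact hγ.1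
    · exact hγ.2
  | wh B γ _ => cases hs; exact ⟨hγ, hγ⟩

theorem extend_of_getLast?_some {I : Interp Ag V F R} {σ : Profile I} {h : List (Cfg I)}
    {γ : Mech Ag V F R} {s : State I} (hl : h.getLast? = some (some γ, s)) :
    extend I σ h = h ++ [next I σ h γ s] := by
  simp only [extend, hl]

theorem extend_of_getLast?_none {I : Interp Ag V F R} {σ : Profile I} {h : List (Cfg I)}
    {s : State I} (hl : h.getLast? = some (none, s)) : extend I σ h = h := by
  simp only [extend, hl]

theorem IsHist.extend {I : Interp Ag V F R} {c0 : Cfg I} {h : List (Cfg I)}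
    (hh : IsHist I c0 h) (σ : Profile I) : IsHist I c0 (extend I σ h) := by
  rcases hl : h.getLast? with _ | ⟨_ | γ, s⟩
  · simpa only [MPL.extend, hl] using hh
  · rwa [extend_of_getLast?_none hl]
  · rw [extend_of_getLast?_some hl]
    refine ⟨by simp [hh.1], List.isChain_append.2 ⟨hh.2, by simp, ?_⟩⟩
    intro x hx y hy
    rw [hl] at hx
    simp only [Option.mem_def, Option.some.injEq, List.head?_cons] at hx hy
    subst hx hy
    exact exists_step_next I σ h γ s

theorem isHist_runH (I : Interp Ag V F R) (c0 : Cfg I) (σ : Profile I) (n : ℕ) :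
    IsHist I c0 (runH I c0 σ n) := by
  induction n with
  | zero => exact ⟨rfl, List.isChain_singleton _⟩
  | succ n ih => exact ih.extend σ

/-- Every history of a choice-free mechanism is an initial part of the run of any profile. -/
theorem IsHist.exists_runH_eq {I : Interp Ag V F R} {γ : Mech Ag V F R} {s : State I}
    {h : List (Cfg I)} (hh : IsHist I (some γ, s) h) (hγ : ChoiceFree γ) (σ : Profile I) :
    (∃ n, runH I (some γ, s) σ n = h) ∧
      ∀ γ' s', h.getLast? = some (some γ', s') → ChoiceFree γ' := by
  induction h using List.reverseRecOn with
  | nil => simp [IsHist] at hh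
  | append_singleton h c ih =>
    obtain ⟨hhead, hchain⟩ := hh
    obtain ⟨hc, -, hstep⟩ := List.isChain_append.1 hchain
    rcases hl : h.getLast? with _ | ⟨o, s1⟩
    · obtain rfl := List.getLast?_eq_none_iff.1 hl
      obtain rfl : c = (some γ, s) := by simpa using hhead
      refine ⟨⟨0, rfl⟩, fun γ' s' h' => ?_⟩
      obtain ⟨rfl, rfl⟩ : γ = γ' ∧ s = s' := by simpa using h'
      exact hγ
    · have hne : h ≠ [] := by rintro rfl; simp at hl
      obtain ⟨⟨n, hn⟩, hcf⟩ := ih ⟨by rwa [List.head?_append_of_ne_nil _ hne] at hhead, hc⟩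
      obtain ⟨L, hL⟩ := hstep _ hl c (by simp)
      cases o with
      | none => cases hL
      | some γ1 =>
        have hγ1 := hcf γ1 s1 hl
        refine ⟨⟨n + 1, ?_⟩, fun γ' s' h' => ?_⟩
        · rw [runH, hn, extend_of_getLast?_some hl, ← hL.eq_next hγ1]
        · obtain rfl : c = (some γ', s') := by simpa using h'
          exact hL.choiceFree hγ1

theorem runH_eq_of_le {I : Interp Ag V F R} {c0 : Cfg I} {σ : Profile I} {n m : ℕ}
    {s : State I} (hn : (runH I c0 σ n).getLast? = some (none, s)) (hnm : n ≤ m) :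
    runH I c0 σ m = runH I c0 σ n := by
  induction m, hnm using Nat.le_induction with
  | base => rfl
  | succ m _ ih => rw [runH, ih, extend_of_getLast?_none hn]

theorem finalState_eq {I : Interp Ag V F R} {c0 : Cfg I} {σ : Profile I} {n : ℕ}
    {t : State I} (hn : (runH I c0 σ n).getLast? = some (none, t))
    (ht : Terminates I c0 σ) : finalState I ht = t := by
  have hm : (runH I c0 σ ht.choose).getLast? = some (none, finalState I ht) :=
    ht.choose_spec.choose_spec
  rcases le_total n ht.choose with hle | hle
  · rw [runH_eq_of_le hn hle, hn] at hm
    simpa using hm.symm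
  · rw [runH_eq_of_le hm hle, hm] at hn
    simpa using hn

end MPL

open MPL in
/-- Generalization of Hoare partial correctness: for any `d` in the domain and any
program `γ` (mechanism without `ch_A`), the standard partial correctness assertion
`{P}γ{Q}` holds in `I` iff `I ⊨ {P*}γ{Q*}` where `P* = {(s,d) : s ∈ P}` and
`Q* = {(s,d) : s ∈ Q}`. -/
theorem hoare_generalization {Ag V F R : Type} (I : Interp Ag V F R) (d : I.D)
    (γ : Mech Ag V F R) (hγ : ChoiceFree γ) (P Q : Set (State I)) :
    HoarePartial I P γ Q ↔
      Valid I {so : State I × I.D | so.1 ∈ P ∧ so.2 = d} γ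
        {so : State I × I.D | so.1 ∈ Q ∧ so.2 = d} := by
  constructor
  · rintro hH ⟨s, _⟩ ⟨hs, rfl⟩
    refine ⟨fun _ => _, fun _ _ => I.worst, fun σ ht => ⟨?_, rfl⟩, ?_, rfl⟩
    · exact hH s hs _ _ (isHist_runH I _ σ _) ht.choose_spec.choose_spec
    · exact fun _ _ _ _ i _ _ => I.pref_refl i _
  · intro hV s hs h t hh hl
    obtain ⟨oh, σ, hoh, -, -⟩ := hV (s, d) ⟨hs, rfl⟩
    obtain ⟨⟨n, rfl⟩, -⟩ := hh.exists_runH_eq hγ σ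
    have ht : Terminates I (some γ, s) σ := ⟨n, t, hl⟩
    have hQ : finalState I ht ∈ Q := (hoh σ ht).1
    rwa [finalState_eq hl ht] at hQ
end
end

section
/- In the two-player sealed-bid second-price auction, suppose v1 ≥ v2. Then: (i) every bid profile (x1,x2) with x2 = v2 and x1 ≥ v2 is a Nash equilibrium, with payoffs (v1 − v2, 0); (ii) if v1 = v2, every bid profile (x1,x2) with x1 = v1 and x2 > v1 is a Nash equilibrium, with payoffs (0,0) = (v1 − v2, 0); and (iii) conversely, every bid profile (x1,x2) whose payoffs are u1(x1,x2) = v1 − v2 and u2(x1,x2) = 0 satisfies either x1 ≥ x2, x2 = v2 and x1 ≥ v2, or x1 < x2, v1 = v2, x1 = v1 and x2 > v1. -/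
/-- Payoff of player 1 in the two-player sealed-bid second-price auction
(ties broken in favour of player 1). -/
def u1 (v1 _v2 x1 x2 : ℕ) : ℤ := if x1 ≥ x2 then (v1 : ℤ) - x2 else 0

/-- Payoff of player 2 in the two-player sealed-bid second-price auction. -/
def u2 (_v1 v2 x1 x2 : ℕ) : ℤ := if x1 ≥ x2 then 0 else (v2 : ℤ) - x1

/-- `(x1,x2)` is a Nash equilibrium of the sealed-bid second-price auction. -/
def SecondPriceNash (v1 v2 x1 x2 : ℕ) : Prop :=
  (∀ y : ℕ, u1 v1 v2 x1 x2 ≥ u1 v1 v2 y x2) ∧ (∀ y : ℕ, u2 v1 v2 x1 x2 ≥ u2 v1 v2 x1 y)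

/-- Characterization of the profiles of the second-price auction (with `v1 ≥ v2`)
yielding payoffs `(v1 − v2, 0)`. -/
theorem second_price_characterization (v1 v2 : ℕ) (h : v1 ≥ v2) :
    (∀ x1 x2 : ℕ, x2 = v2 → x1 ≥ v2 →
      SecondPriceNash v1 v2 x1 x2 ∧ u1 v1 v2 x1 x2 = (v1 : ℤ) - v2 ∧ u2 v1 v2 x1 x2 = 0) ∧
    (v1 = v2 → ∀ x1 x2 : ℕ, x1 = v1 → x2 > v1 →
      SecondPriceNash v1 v2 x1 x2 ∧ u1 v1 v2 x1 x2 = 0 ∧ u2 v1 v2 x1 x2 = 0 ∧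
      u1 v1 v2 x1 x2 = (v1 : ℤ) - v2) ∧
    (∀ x1 x2 : ℕ, u1 v1 v2 x1 x2 = (v1 : ℤ) - v2 → u2 v1 v2 x1 x2 = 0 →
      (x1 ≥ x2 ∧ x2 = v2 ∧ x1 ≥ v2) ∨ (x1 < x2 ∧ v1 = v2 ∧ x1 = v1 ∧ x2 > v1)) := by
  unfold SecondPriceNash u1 u2
  refine ⟨fun x1 x2 h2 h1 => ⟨⟨fun y => ?_, fun y => ?_⟩, ?_, ?_⟩,
    fun hv x1 x2 h1 h2 => ⟨⟨fun y => ?_, fun y => ?_⟩, ?_, ?_, ?_⟩,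
    fun x1 x2 hu1 hu2 => ?_⟩
  all_goals split_ifs at * <;> omega
end
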